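/- Let I ⊆ R be a monomial ideal and m ≥ 1 an integer. Then the integral closure of the m-th square power of I equals the integral closure of the m-th ordinary power of I: the closure of I^[m] equals the closure of I^m. -/

import Mathlib

/-- The `m`-th square power `f^[m] = f(X_1^m, …, X_n^m)` of a polynomial `f`. -/
noncomputable def sqPoly {n : ℕ} {K : Type*} [Field K] (m : ℕ)
    (f : MvPolynomial (Fin n) K) : MvPolynomial (Fin n) K :=
  MvPolynomial.aeval (fun i => (MvPolynomial.X i : MvPolynomial (Fin n) K) ^ m) f

/-- The `m`-th square power `I^[m] = ⟨f^[m] : f ∈ I⟩` of an ideal `I`. -/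
noncomputable def sqPow {n : ℕ} {K : Type*} [Field K] (m : ℕ)
    (I : Ideal (MvPolynomial (Fin n) K)) : Ideal (MvPolynomial (Fin n) K) :=
  I.map (MvPolynomial.aeval (fun i => (MvPolynomial.X i : MvPolynomial (Fin n) K) ^ m))
/-- A monomial ideal: an ideal generated by a set of monomials `X^a`. -/
def IsMonomialIdeal {n : ℕ} {K : Type*} [Field K] (I : Ideal (MvPolynomial (Fin n) K)) : Prop :=
  ∃ A : Set (Fin n →₀ ℕ), I = Ideal.span ((fun a => (MvPolynomial.monomial a (1 : K))) '' A)
/-- The integral closure of an ideal `J`: the set of all `f` satisfying an equation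
`f^k + a_1 f^(k-1) + ⋯ + a_k = 0` with `a_i ∈ J^i`. -/
def integralClosureSet {R : Type*} [CommRing R] (J : Ideal R) : Set R :=
  {f | ∃ k : ℕ, 0 < k ∧ ∃ a : ℕ → R,
    (∀ i, 1 ≤ i → i ≤ k → a i ∈ J ^ i) ∧
    f ^ k + ∑ i ∈ Finset.Icc 1 k, a i * f ^ (k - i) = 0}

open Polynomial in
/-- If `f t` is integral over the Rees algebra of `J`, then `f` is integral over the ideal `J`. -/
lemma mem_integralClosureSet_of_isIntegral_reesAlgebra {R : Type*} [CommRing R] [Nontrivial R]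
    {J : Ideal R} {f : R} (hf : IsIntegral (reesAlgebra J) (monomial 1 f)) :
    f ∈ integralClosureSet J := by
  obtain ⟨p, hp, hpf⟩ := hf
  have hpos : 0 < p.natDegree := by
    rw [hp.natDegree_pos]
    rintro rfl
    simp at hpf
  refine ⟨p.natDegree, hpos, fun i => (p.coeff (p.natDegree - i) : R[X]).coeff i,
    fun i _ _ => (p.coeff (p.natDegree - i)).2 i, ?_⟩
  have hterm : ∀ j ∈ Finset.range (p.natDegree + 1),
      ((p.coeff j : R[X]) * (monomial 1 f) ^ j).coeff p.natDegree =
        (p.coeff j : R[X]).coeff (p.natDegree - j) * f ^ j := by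
    intro j hj
    have hj' : j ≤ p.natDegree := Nat.lt_succ_iff.mp (Finset.mem_range.mp hj)
    conv_lhs => rw [← Nat.sub_add_cancel hj']
    rw [monomial_pow, one_mul, coeff_mul_monomial]
  have h := congrArg (fun q : R[X] => q.coeff p.natDegree) hpf
  simp only [eval₂_eq_sum_range, finsetSum_coeff, coeff_zero] at h
  have h' := (Finset.sum_congr rfl hterm).symm.trans h
  rw [Finset.sum_range_succ, hp.coeff_natDegree, Nat.sub_self, OneMemClass.coe_one,
    coeff_one_zero, one_mul, add_comm] at h'
  rw [← h']
  congr 1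
  refine Finset.sum_nbij' (p.natDegree - ·) (p.natDegree - ·) ?_ ?_ ?_ ?_ ?_ <;> intro i hi <;>
    simp only [Finset.mem_Icc, Finset.mem_range] at hi ⊢
  any_goals omega
  rw [Nat.sub_sub_self hi.2]

open Polynomial in
/-- A root of a monic equation whose `i`-th coefficient `a i`, placed in degree `i`, is integral
over the Rees algebra of `J` is itself integral over the ideal `J`. -/
lemma isIntegral_reesAlgebra_of_equation {R : Type*} [CommRing R]
    {J : Ideal R} {f : R} {k : ℕ} {a : ℕ → R}
    (ha : ∀ i, 1 ≤ i → i ≤ k → IsIntegral (reesAlgebra J) (monomial i (a i)))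
    (h : f ^ k + ∑ i ∈ Finset.Icc 1 k, a i * f ^ (k - i) = 0) :
    IsIntegral (reesAlgebra J) (monomial 1 f) := by
  classical
  let c : ℕ → integralClosure (reesAlgebra J) R[X] := fun i =>
    if hi : 1 ≤ i ∧ i ≤ k then ⟨monomial i (a i), ha i hi.1 hi.2⟩ else 0
  have hc : ∀ i ∈ Finset.Icc 1 k, (c i : R[X]) = monomial i (a i) := fun i hi => by
    simp only [c, dif_pos (Finset.mem_Icc.mp hi)]
  refine isIntegral_trans (A := integralClosure (reesAlgebra J) R[X]) _
    ⟨X ^ k + ∑ i ∈ Finset.Icc 1 k, C (c i) * X ^ (k - i), monic_X_pow_add ?_, ?_⟩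
  · refine (degree_sum_le _ _).trans_lt ((Finset.sup_lt_iff (WithBot.bot_lt_coe k)).2 ?_)
    intro i hi
    obtain ⟨h1, h2⟩ := Finset.mem_Icc.mp hi
    exact (degree_C_mul_X_pow_le _ _).trans_lt (Nat.cast_lt.mpr (by omega))
  · have hterm : ∀ i ∈ Finset.Icc 1 k,
        (c i : R[X]) * (monomial 1 f) ^ (k - i) = monomial k (a i * f ^ (k - i)) := by
      intro i hi
      rw [hc i hi, monomial_pow, one_mul, monomial_mul_monomial,
        Nat.add_sub_cancel' (Finset.mem_Icc.mp hi).2]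
    simp only [eval₂_add, eval₂_finsetSum, eval₂_mul, eval₂_C, eval₂_X_pow]
    refine (congrArg _ (Finset.sum_congr rfl hterm)).trans ?_
    rw [monomial_pow, one_mul, ← map_sum, ← map_add, h, map_zero]

open Polynomial Pointwise in
/-- Elements of `(span S) ^ (m * i)`, placed in degree `i`, are integral over the Rees algebra of
the ideal generated by the `m`-th powers of the elements of `S`. -/
lemma isIntegral_reesAlgebra_span_pow {R : Type*} [CommRing R] (S : Set R) {m : ℕ} (hm : 0 < m)
    (i : ℕ) {x : R} (hx : x ∈ Ideal.span S ^ (m * i)) :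
    IsIntegral (reesAlgebra (Ideal.span ((· ^ m) '' S))) (monomial i x) := by
  set J := Ideal.span ((· ^ m) '' S)
  have hS : ∀ N : ℕ, ∀ y ∈ S ^ N, y ^ m ∈ J ^ N := by
    intro N
    induction N with
    | zero => simp
    | succ N ih =>
      intro y hy
      obtain ⟨u, hu, v, hv, rfl⟩ := Set.mem_mul.mp (pow_succ S N ▸ hy)
      rw [mul_pow, pow_succ]
      exact Ideal.mul_mem_mul (ih u hu) (Ideal.subset_span ⟨v, hv, rfl⟩)
  rw [Ideal.span, Submodule.span_pow] at hx
  induction hx using Submodule.span_induction with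
  | zero => simpa using isIntegral_zero
  | add u v _ _ hu hv => simpa using hu.add hv
  | smul r u _ hu =>
    have : (monomial i (r • u) : R[X]) = algebraMap R (reesAlgebra J) r • monomial i u := by
      rw [algebraMap_smul, smul_monomial]
    rw [this]
    exact hu.smul _
  | mem y hy =>
    refine IsIntegral.of_pow hm ?_
    have hmem : (monomial i y : R[X]) ^ m ∈ reesAlgebra J := by
      rw [monomial_pow, mul_comm i m]
      exact reesAlgebra.monomial_mem.mpr (hS _ y hy)
    exact isIntegral_algebraMap (R := reesAlgebra J) (x := ⟨_, hmem⟩)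

/-- Integral closure of ideals is monotone. -/
lemma integralClosureSet_mono {R : Type*} [CommRing R] {I J : Ideal R} (h : I ≤ J) :
    integralClosureSet I ⊆ integralClosureSet J := by
  rintro f ⟨k, hk, a, ha, hf⟩
  exact ⟨k, hk, a, fun i h1 h2 => Ideal.pow_right_mono h i (ha i h1 h2), hf⟩

/-- The `m`-th powers of a generating set of an ideal generate an ideal with the same integral
closure as the `m`-th power of the ideal. -/
lemma integralClosureSet_span_image_pow {R : Type*} [CommRing R] [Nontrivial R] (S : Set R)
    {m : ℕ} (hm : 0 < m) :
    integralClosureSet (Ideal.span ((· ^ m) '' S)) = integralClosureSet (Ideal.span S ^ m) := by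
  apply Set.Subset.antisymm
  · apply integralClosureSet_mono
    rw [Ideal.span_le]
    rintro _ ⟨s, hs, rfl⟩
    exact Ideal.pow_mem_pow (Ideal.subset_span hs) m
  · rintro f ⟨k, -, a, ha, hf⟩
    refine mem_integralClosureSet_of_isIntegral_reesAlgebra
      (isIntegral_reesAlgebra_of_equation (fun i h1 h2 => ?_) hf)
    exact isIntegral_reesAlgebra_span_pow S hm i (pow_mul (Ideal.span S) m i ▸ ha i h1 h2)

/-- The square power of the ideal generated by a set of monomials is generated by the powers of
these monomials. -/
lemma sqPow_span_monomial {n : ℕ} {K : Type*} [Field K] (m : ℕ) (A : Set (Fin n →₀ ℕ)) :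
    sqPow m (Ideal.span ((fun a => MvPolynomial.monomial a (1 : K)) '' A)) =
      Ideal.span ((· ^ m) '' ((fun a => MvPolynomial.monomial a (1 : K)) '' A)) := by
  rw [sqPow, Ideal.map_span, Set.image_image, Set.image_image]
  congr 1
  refine Set.image_congr fun a _ => ?_
  simp only [MvPolynomial.aeval_monomial, map_one, one_mul, Finsupp.prod, pow_right_comm _ m]
  rw [Finset.prod_pow, MvPolynomial.prod_X_pow_eq_monomial]

/-- Let `I` be a monomial ideal and `m ≥ 1`. Then the integral closure
of `I^[m]` equals the integral closure of `I^m`. -/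
theorem sqPow_integralClosure (n : ℕ) (K : Type*) [Field K]
    (I : Ideal (MvPolynomial (Fin n) K)) (hI : IsMonomialIdeal I) (m : ℕ) (hm : 1 ≤ m) :
    integralClosureSet (sqPow m I) = integralClosureSet (I ^ m) := by
  obtain ⟨A, rfl⟩ := hI
  rw [sqPow_span_monomial, integralClosureSet_span_image_pow _ hm]
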